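/- Let L ≥ ‖D‖², fix a row index l, let z* ∈ ℝⁿ with S* = supp(z*), and assume the Gram matrix (D_{:,S*})ᵀ D_{:,S*} is invertible with smallest eigenvalue μ > 0. Let (z_k)_{k≥0} be a sequence in ℝⁿ converging to z* and such that supp(z_k) = S* for all k ≥ N₀. Let (J_k)_{k≥0} be defined from an arbitrary initial n×n matrix J_0 by J_{k+1} = 1_{supp(z_{k+1})} ⊙ (G J_k + u^{z_k}). Then J_k converges to the closed-form Jacobian J*_l as k → ∞. -/

import Mathlib

open scoped BigOperators
open Matrix

noncomputable def eunorm {α : Type*} [Fintype α] (v : α → ℝ) : ℝ :=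
  Real.sqrt (∑ i, v i ^ 2)

noncomputable def frobnorm {α β : Type*} [Fintype α] [Fintype β] (A : Matrix α β ℝ) : ℝ :=
  Real.sqrt (∑ i, ∑ j, A i j ^ 2)

noncomputable def l2opnorm {α β : Type*} [Fintype α] [Fintype β] (A : Matrix α β ℝ) : ℝ :=
  sInf {c : ℝ | 0 ≤ c ∧ ∀ v : β → ℝ, eunorm (A.mulVec v) ≤ c * eunorm v}

open scoped Classical in
noncomputable def supp {n : ℕ} (z : Fin n → ℝ) : Finset (Fin n) :=
  Finset.univ.filter fun i => z i ≠ 0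

noncomputable def rowMask {n : ℕ} (S : Finset (Fin n)) (M : Matrix (Fin n) (Fin n) ℝ) :
    Matrix (Fin n) (Fin n) ℝ :=
  Matrix.of fun i j => if i ∈ S then M i j else 0

def restrVec {n : ℕ} (S : Finset (Fin n)) (h : Fin n → ℝ) : Fin n → ℝ :=
  fun i => if i ∈ S then h i else 0

def colSub {m n : ℕ} (D : Matrix (Fin m) (Fin n) ℝ) (S : Finset (Fin n)) :
    Matrix (Fin m) {i // i ∈ S} ℝ :=
  D.submatrix id Subtype.val

noncomputable def gram {m n : ℕ} (D : Matrix (Fin m) (Fin n) ℝ) (S : Finset (Fin n)) :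
    Matrix {i // i ∈ S} {i // i ∈ S} ℝ :=
  (colSub D S)ᵀ * colSub D S

noncomputable def Nmat {m n : ℕ} (D : Matrix (Fin m) (Fin n) ℝ) (y : Fin m → ℝ)
    (l : Fin m) (z : Fin n → ℝ) : Matrix (Fin n) (Fin n) ℝ :=
  Matrix.vecMulVec (D l) z + (dotProduct (D l) z - y l) • (1 : Matrix (Fin n) (Fin n) ℝ)

noncomputable def umat {m n : ℕ} (D : Matrix (Fin m) (Fin n) ℝ) (y : Fin m → ℝ)
    (l : Fin m) (L : ℝ) (z : Fin n → ℝ) : Matrix (Fin n) (Fin n) ℝ :=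
  (-(1 / L)) • Nmat D y l z

noncomputable def Gmat {m n : ℕ} (D : Matrix (Fin m) (Fin n) ℝ) (L : ℝ) :
    Matrix (Fin n) (Fin n) ℝ :=
  1 - (1 / L) • (Dᵀ * D)

noncomputable def Jstar {m n : ℕ} (D : Matrix (Fin m) (Fin n) ℝ) (y : Fin m → ℝ)
    (l : Fin m) (z : Fin n → ℝ) (S : Finset (Fin n)) : Matrix (Fin n) (Fin n) ℝ :=
  Matrix.of fun i j =>
    if h : i ∈ S then
      (-((gram D S)⁻¹ * (Nmat D y l z).submatrix (Subtype.val : {i // i ∈ S} → Fin n) id))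
        ⟨i, h⟩ j
    else 0

noncomputable def Rmap {m n : ℕ} (D : Matrix (Fin m) (Fin n) ℝ) (y : Fin m → ℝ)
    (zstar : Fin n → ℝ) (J : Fin m → Matrix (Fin n) (Fin n) ℝ) (S : Finset (Fin n))
    (h : Fin n → ℝ) : Matrix (Fin m) (Fin n) ℝ :=
  Matrix.of fun l j =>
    ((J l)ᵀ.mulVec ((Dᵀ * D).mulVec (restrVec S h))) j
      + (D.mulVec (restrVec S h)) l * zstar j
      + (D.mulVec zstar - y) l * restrVec S h j

noncomputable def mapOpNorm {m n : ℕ} (Φ : (Fin n → ℝ) → Matrix (Fin m) (Fin n) ℝ) : ℝ :=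
  sInf {c : ℝ | 0 ≤ c ∧ ∀ h : Fin n → ℝ, frobnorm (Φ h) ≤ c * eunorm h}

noncomputable def Mmat {m n : ℕ} (D : Matrix (Fin m) (Fin n) ℝ) (Sstar E : Finset (Fin n))
    (U : Matrix (Fin n) (Fin n) ℝ) : Matrix (Fin n) (Fin n) ℝ :=
  Matrix.of fun i j =>
    if h : i ∈ E then
      U i j -
        ((colSub D E)ᵀ * colSub D Sstar * (gram D Sstar)⁻¹ *
          U.submatrix (Subtype.val : {i // i ∈ Sstar} → Fin n) id) ⟨i, h⟩ j
    else 0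

noncomputable def Cmat {m n : ℕ} (D : Matrix (Fin m) (Fin n) ℝ) (Sstar E : Finset (Fin n)) :
    Matrix (Fin n) (Fin n) ℝ :=
  Matrix.of fun i j =>
    if h : i ∈ E then
      if h' : j ∈ Sstar then
        ((colSub D E)ᵀ * colSub D Sstar * (gram D Sstar)⁻¹) ⟨i, h⟩ ⟨j, h'⟩
      else 0
    else 0

noncomputable def Pdiag {n : ℕ} (S : Finset (Fin n)) : Matrix (Fin n) (Fin n) ℝ :=
  Matrix.diagonal fun i => if i ∈ S then (1 : ℝ) else 0

noncomputable def STv {n : ℕ} (μ : ℝ) (x : Fin n → ℝ) : Fin n → ℝ :=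
  fun i => Real.sign (x i) * max (|x i| - μ) 0

theorem tendsto_zero_of_le_mul_add {a d : ℕ → ℝ} {ρ : ℝ} (hρ0 : 0 ≤ ρ) (hρ1 : ρ < 1)
    (ha : ∀ k, 0 ≤ a k) (hd : Filter.Tendsto d Filter.atTop (nhds 0))
    (hstep : ∀ k, a (k + 1) ≤ ρ * a k + d k) :
    Filter.Tendsto a Filter.atTop (nhds 0) := by
  rw [Metric.tendsto_atTop]
  intro ε hε
  have hδ : 0 < (1 - ρ) * (ε / 2) := mul_pos (by linarith) (by linarith)
  obtain ⟨N, hN⟩ := Filter.eventually_atTop.1 (hd.eventually_lt_const hδ)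
  have hgeom : ∀ k, a (N + k) - ε / 2 ≤ ρ ^ k * a N := by
    intro k
    induction k with
    | zero => simp; linarith
    | succ k ih =>
      have h1 := hstep (N + k)
      have h2 := hN (N + k) (by omega)
      have h3 := mul_le_mul_of_nonneg_left ih hρ0
      rw [← add_assoc, pow_succ]
      nlinarith
  have hpow : Filter.Tendsto (fun k : ℕ => ρ ^ k * a N) Filter.atTop (nhds 0) := by
    simpa using (tendsto_pow_atTop_nhds_zero_of_lt_one hρ0 hρ1).mul_const (a N)
  obtain ⟨K, hK⟩ := Filter.eventually_atTop.1 (hpow.eventually_lt_const (half_pos hε))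
  refine ⟨N + K, fun k hk => ?_⟩
  obtain ⟨p, rfl⟩ := Nat.exists_eq_add_of_le (show N ≤ k by omega)
  rw [Real.dist_eq, sub_zero, abs_of_nonneg (ha _)]
  linarith [hgeom p, hK p (by omega)]

theorem eunorm_eq_norm {α : Type*} [Fintype α] (v : α → ℝ) :
    eunorm v = ‖WithLp.toLp 2 v‖ := by
  simp [eunorm, EuclideanSpace.norm_eq]

theorem eunorm_nonneg {α : Type*} [Fintype α] (v : α → ℝ) : 0 ≤ eunorm v :=
  Real.sqrt_nonneg _

theorem eunorm_sq {α : Type*} [Fintype α] (v : α → ℝ) : eunorm v ^ 2 = v ⬝ᵥ v := by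
  rw [eunorm, Real.sq_sqrt (Finset.sum_nonneg fun _ _ => sq_nonneg _)]
  simp [dotProduct, sq]

theorem eunorm_add_le {α : Type*} [Fintype α] (v w : α → ℝ) :
    eunorm (v + w) ≤ eunorm v + eunorm w := by
  simp only [eunorm_eq_norm, WithLp.toLp_add]
  exact norm_add_le _ _

theorem abs_le_eunorm {α : Type*} [Fintype α] (v : α → ℝ) (i : α) : |v i| ≤ eunorm v := by
  rw [eunorm_eq_norm, ← Real.norm_eq_abs]
  exact PiLp.norm_apply_le (WithLp.toLp 2 v) i

theorem continuous_eunorm {α : Type*} [Fintype α] :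
    Continuous (eunorm : (α → ℝ) → ℝ) := by
  unfold eunorm
  fun_prop

theorem exists_eunorm_mulVec_le {α β : Type*} [Fintype α] [Fintype β] (A : Matrix α β ℝ) :
    ∃ c : ℝ, 0 ≤ c ∧ ∀ v : β → ℝ, eunorm (A *ᵥ v) ≤ c * eunorm v := by
  classical
  let T := (Matrix.toEuclideanLin A).toContinuousLinearMap
  refine ⟨‖T‖, norm_nonneg _, fun v => ?_⟩
  rw [eunorm_eq_norm, eunorm_eq_norm]
  exact T.le_opNorm (WithLp.toLp 2 v)

theorem eunorm_mulVec_le {α β : Type*} [Fintype α] [Fintype β] (A : Matrix α β ℝ)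
    (v : β → ℝ) : eunorm (A *ᵥ v) ≤ l2opnorm A * eunorm v := by
  rcases (eunorm_nonneg v).eq_or_lt with h0 | hpos
  · obtain ⟨c, -, hc⟩ := exists_eunorm_mulVec_le A
    simpa [← h0] using hc v
  · rw [← div_le_iff₀ hpos]
    refine le_csInf (exists_eunorm_mulVec_le A) ?_
    rintro c ⟨-, hc⟩
    rw [div_le_iff₀ hpos]
    exact hc v

/-- Gradient steps for a least-squares problem with invertible Gram matrix contract. -/
theorem exists_contraction_sub_smul_gram {α β : Type*} [Fintype α] [Fintype β] [DecidableEq β]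
    (B : Matrix α β ℝ) (hunit : IsUnit (Bᵀ * B)) {L : ℝ} (hLpos : 0 < L)
    (hB : ∀ w : β → ℝ, eunorm (B *ᵥ w) ^ 2 ≤ L * eunorm w ^ 2) :
    ∃ ρ : ℝ, 0 ≤ ρ ∧ ρ < 1 ∧
      ∀ v : β → ℝ, eunorm (v - (1 / L) • ((Bᵀ * B) *ᵥ v)) ≤ ρ * eunorm v := by
  have hdet := (Matrix.isUnit_iff_isUnit_det _).1 hunit
  obtain ⟨c, hc0, hc⟩ := exists_eunorm_mulVec_le ((Bᵀ * B)⁻¹ * Bᵀ)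
  have hinner : ∀ v w : β → ℝ, v ⬝ᵥ ((Bᵀ * B) *ᵥ w) = (B *ᵥ v) ⬝ᵥ (B *ᵥ w) := by
    intro v w
    rw [← Matrix.mulVec_mulVec, Matrix.dotProduct_mulVec, Matrix.vecMul_transpose]
  have hlow : ∀ v : β → ℝ, eunorm v ^ 2 ≤ c ^ 2 * eunorm (B *ᵥ v) ^ 2 := by
    intro v
    have h := hc (B *ᵥ v)
    rw [Matrix.mulVec_mulVec, Matrix.mul_assoc, Matrix.nonsing_inv_mul _ hdet,
      Matrix.one_mulVec] at h
    rw [← mul_pow]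
    exact pow_le_pow_left₀ (eunorm_nonneg _) h 2
  have hhigh : ∀ v : β → ℝ, eunorm ((Bᵀ * B) *ᵥ v) ^ 2 ≤ L * eunorm (B *ᵥ v) ^ 2 := by
    intro v
    have h1 := hB ((Bᵀ * B) *ᵥ v)
    have h2 : eunorm ((Bᵀ * B) *ᵥ v) ^ 2 = (B *ᵥ ((Bᵀ * B) *ᵥ v)) ⬝ᵥ (B *ᵥ v) := by
      rw [eunorm_sq, hinner]
    have h3 : ((B *ᵥ ((Bᵀ * B) *ᵥ v)) ⬝ᵥ (B *ᵥ v)) ^ 2 ≤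
        eunorm (B *ᵥ ((Bᵀ * B) *ᵥ v)) ^ 2 * eunorm (B *ᵥ v) ^ 2 := by
      rw [eunorm_sq, eunorm_sq]
      simpa [dotProduct, sq] using Finset.sum_mul_sq_le_sq_mul_sq Finset.univ
        (B *ᵥ ((Bᵀ * B) *ᵥ v)) (B *ᵥ v)
    rw [← h2] at h3
    have h4 := mul_le_mul_of_nonneg_right h1 (sq_nonneg (eunorm (B *ᵥ v)))
    rcases (sq_nonneg (eunorm ((Bᵀ * B) *ᵥ v))).eq_or_lt with h0 | hpos
    · rw [← h0]; positivity
    · refine le_of_mul_le_mul_left ?_ hpos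
      nlinarith
  set K : ℝ := c ^ 2 + 1 / L with hK
  have hKpos : 0 < K := by positivity
  have hLK : 1 ≤ L * K := by
    rw [hK, mul_add, mul_one_div_cancel hLpos.ne']
    nlinarith [mul_nonneg hLpos.le (sq_nonneg c)]
  have hLK' : 1 / (L * K) ≤ 1 := by
    rw [div_le_one (by positivity)]; exact hLK
  refine ⟨Real.sqrt (1 - 1 / (L * K)), Real.sqrt_nonneg _, ?_, fun v => ?_⟩
  · rw [Real.sqrt_lt' one_pos]
    have : 0 < 1 / (L * K) := by positivity
    linarith
  · refine (sq_le_sq₀ (eunorm_nonneg _) (mul_nonneg (Real.sqrt_nonneg _) (eunorm_nonneg _))).1 ?_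
    rw [mul_pow, Real.sq_sqrt (by linarith)]
    have hexp : eunorm (v - (1 / L) • ((Bᵀ * B) *ᵥ v)) ^ 2 = eunorm v ^ 2
        - 2 * (1 / L) * eunorm (B *ᵥ v) ^ 2 + (1 / L) ^ 2 * eunorm ((Bᵀ * B) *ᵥ v) ^ 2 := by
      simp only [eunorm_sq]
      rw [← hinner v v]
      simp only [sub_dotProduct, dotProduct_sub, smul_dotProduct, dotProduct_smul, smul_eq_mul]
      rw [dotProduct_comm ((Bᵀ * B) *ᵥ v) v]
      ring
    have hlast : (1 / L) ^ 2 * eunorm ((Bᵀ * B) *ᵥ v) ^ 2 ≤ (1 / L) * eunorm (B *ᵥ v) ^ 2 := by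
      calc (1 / L) ^ 2 * eunorm ((Bᵀ * B) *ᵥ v) ^ 2
          ≤ (1 / L) ^ 2 * (L * eunorm (B *ᵥ v) ^ 2) :=
            mul_le_mul_of_nonneg_left (hhigh v) (sq_nonneg _)
        _ = (1 / L) * eunorm (B *ᵥ v) ^ 2 := by field_simp
    have hKv : eunorm v ^ 2 ≤ K * eunorm (B *ᵥ v) ^ 2 := by
      have : 0 ≤ 1 / L * eunorm (B *ᵥ v) ^ 2 := by positivity
      rw [hK, add_mul]
      linarith [hlow v]
    have hmain : 1 / (L * K) * eunorm v ^ 2 ≤ 1 / L * eunorm (B *ᵥ v) ^ 2 := by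
      calc 1 / (L * K) * eunorm v ^ 2 ≤ 1 / (L * K) * (K * eunorm (B *ᵥ v) ^ 2) :=
            mul_le_mul_of_nonneg_left hKv (by positivity)
        _ = 1 / L * eunorm (B *ᵥ v) ^ 2 := by field_simp
    rw [hexp]
    linarith

theorem tendsto_perturbed_gradient_descent {α β : Type*} [Fintype α] [Fintype β] [DecidableEq β]
    (B : Matrix α β ℝ) (hunit : IsUnit (Bᵀ * B)) {L : ℝ} (hLpos : 0 < L)
    (hB : ∀ w : β → ℝ, eunorm (B *ᵥ w) ^ 2 ≤ L * eunorm w ^ 2)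
    {x b : ℕ → β → ℝ} {b' : β → ℝ} (hb : Filter.Tendsto b Filter.atTop (nhds b'))
    (hx : ∀ k, x (k + 1) = x k - (1 / L) • ((Bᵀ * B) *ᵥ x k + b k)) :
    Filter.Tendsto x Filter.atTop (nhds (-((Bᵀ * B)⁻¹ *ᵥ b'))) := by
  obtain ⟨ρ, hρ0, hρ1, hρ⟩ := exists_contraction_sub_smul_gram B hunit hLpos hB
  have hdet := (Matrix.isUnit_iff_isUnit_det _).1 hunit
  set x' := -((Bᵀ * B)⁻¹ *ᵥ b') with hx'
  have hfix : (Bᵀ * B) *ᵥ x' = -b' := by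
    rw [hx', Matrix.mulVec_neg, Matrix.mulVec_mulVec, Matrix.mul_nonsing_inv _ hdet,
      Matrix.one_mulVec]
  have hd : Filter.Tendsto (fun k => eunorm ((1 / L) • (b' - b k))) Filter.atTop (nhds 0) := by
    have h := ((hb.const_sub b').const_smul (1 / L))
    have h2 := (continuous_eunorm.tendsto _).comp h
    simpa [Function.comp_def, eunorm] using h2
  have herr : Filter.Tendsto (fun k => eunorm (x k - x')) Filter.atTop (nhds 0) := by
    refine tendsto_zero_of_le_mul_add hρ0 hρ1 (fun _ => eunorm_nonneg _) hd fun k => ?_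
    have hsplit : x (k + 1) - x' =
        ((x k - x') - (1 / L) • ((Bᵀ * B) *ᵥ (x k - x'))) + (1 / L) • (b' - b k) := by
      rw [hx k, Matrix.mulVec_sub, hfix]
      module
    rw [hsplit]
    exact (eunorm_add_le _ _).trans (by gcongr; exact hρ _)
  rw [tendsto_pi_nhds]
  intro i
  rw [tendsto_iff_dist_tendsto_zero]
  exact squeeze_zero (fun _ => dist_nonneg) (fun k => abs_le_eunorm (x k - x') i) herr

theorem colSub_mulVec {m n : ℕ} (D : Matrix (Fin m) (Fin n) ℝ) (S : Finset (Fin n))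
    (w : {i // i ∈ S} → ℝ) :
    colSub D S *ᵥ w = D *ᵥ fun i => if h : i ∈ S then w ⟨i, h⟩ else 0 := by
  ext a
  simp only [Matrix.mulVec, dotProduct, colSub, Matrix.submatrix_apply, id, mul_dite, mul_zero]
  rw [Finset.sum_dite]
  simp only [Finset.sum_const_zero, add_zero]
  refine Finset.sum_bij' (fun i _ => ⟨i.1, by simp⟩) (fun i _ => ⟨i.1, by simpa using i.2⟩)
    ?_ ?_ ?_ ?_ ?_ <;> simp

theorem eunorm_extend {n : ℕ} (S : Finset (Fin n)) (w : {i // i ∈ S} → ℝ) :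
    eunorm (fun i => if h : i ∈ S then w ⟨i, h⟩ else 0) = eunorm w := by
  unfold eunorm
  congr 1
  rw [← Finset.sum_subset (Finset.subset_univ S) (by intro i _ hi; simp [hi]),
    ← Finset.sum_coe_sort S]
  simp

theorem eunorm_colSub_mulVec_sq_le {m n : ℕ} (D : Matrix (Fin m) (Fin n) ℝ)
    (S : Finset (Fin n)) {L : ℝ} (hL : l2opnorm D ^ 2 ≤ L) (w : {i // i ∈ S} → ℝ) :
    eunorm (colSub D S *ᵥ w) ^ 2 ≤ L * eunorm w ^ 2 := by
  have h := eunorm_mulVec_le D (fun i => if h : i ∈ S then w ⟨i, h⟩ else 0)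
  rw [← colSub_mulVec, eunorm_extend] at h
  calc eunorm (colSub D S *ᵥ w) ^ 2 ≤ (l2opnorm D * eunorm w) ^ 2 :=
        pow_le_pow_left₀ (eunorm_nonneg _) h 2
    _ = l2opnorm D ^ 2 * eunorm w ^ 2 := mul_pow _ _ _
    _ ≤ L * eunorm w ^ 2 := mul_le_mul_of_nonneg_right hL (sq_nonneg _)

theorem pos_of_isUnit_gram {m n : ℕ} (D : Matrix (Fin m) (Fin n) ℝ) (S : Finset (Fin n))
    {L : ℝ} (hL : l2opnorm D ^ 2 ≤ L) (hGram : IsUnit (_root_.gram D S))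
    (i : {i // i ∈ S}) : 0 < L := by
  refine lt_of_le_of_ne ((sq_nonneg _).trans hL) fun h0 => ?_
  have hzero : ∀ w : {i // i ∈ S} → ℝ, colSub D S *ᵥ w = 0 := by
    intro w
    have h := eunorm_colSub_mulVec_sq_le D S hL w
    rw [← h0, zero_mul] at h
    have h1 : eunorm (colSub D S *ᵥ w) = 0 := by
      simpa using le_antisymm h (sq_nonneg _)
    simpa [eunorm_eq_norm] using h1
  have hw := congrArg (fun v => (_root_.gram D S)⁻¹ *ᵥ ((colSub D S)ᵀ *ᵥ v)) (hzero (Pi.single i 1))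
  simp only [Matrix.mulVec_zero] at hw
  rw [Matrix.mulVec_mulVec (Pi.single i 1) (colSub D S)ᵀ, ← _root_.gram, Matrix.mulVec_mulVec,
    Matrix.nonsing_inv_mul _ ((Matrix.isUnit_iff_isUnit_det _).1 hGram),
    Matrix.one_mulVec] at hw
  simpa using congrFun hw i

theorem continuous_Nmat_apply {m n : ℕ} (D : Matrix (Fin m) (Fin n) ℝ) (y : Fin m → ℝ)
    (l : Fin m) (i j : Fin n) : Continuous fun z => Nmat D y l z i j := by
  simp only [Nmat, Matrix.add_apply, Matrix.smul_apply, Matrix.vecMulVec_apply, dotProduct]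
  fun_prop

/-- On a matrix whose rows outside `S` vanish, the `S`-rows of the affine Jacobian update are a
gradient step for the Gram matrix of the columns in `S`. -/
theorem jacobian_step_apply {m n : ℕ} (D : Matrix (Fin m) (Fin n) ℝ) (y : Fin m → ℝ)
    (l : Fin m) (L : ℝ) (z : Fin n → ℝ) (S : Finset (Fin n)) (J : Matrix (Fin n) (Fin n) ℝ)
    (hJ : ∀ i ∉ S, ∀ j, J i j = 0) (i : {i // i ∈ S}) (j : Fin n) :
    (Gmat D L * J + umat D y l L z) i j =
      J i j - (1 / L) * ((((colSub D S)ᵀ * colSub D S) *ᵥ fun p => J p j) i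
        + Nmat D y l z i j) := by
  have hQ : (((colSub D S)ᵀ * colSub D S) *ᵥ fun p => J p j) i = (Dᵀ * D * J) i j := by
    rw [Matrix.mul_apply, ← Finset.sum_subset (Finset.subset_univ S)
      (by intro p _ hp; simp [hJ p hp]), ← Finset.sum_coe_sort S]
    simp [Matrix.mulVec, dotProduct, colSub, Matrix.mul_apply]
  rw [hQ, Gmat, umat, Matrix.sub_mul, Matrix.one_mul, Matrix.smul_mul]
  simp only [Matrix.add_apply, Matrix.sub_apply, Matrix.smul_apply, smul_eq_mul]
  ring

/-- convergence of the unrolled Jacobian recursion to the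
closed-form Jacobian once the supports stabilize. -/
theorem jacobian_recursion_tendsto_closed_form
    {m n : ℕ} (D : Matrix (Fin m) (Fin n) ℝ) (y : Fin m → ℝ) (l : Fin m)
    (L : ℝ) (hL : l2opnorm D ^ 2 ≤ L) (zstar : Fin n → ℝ)
    (hGram : IsUnit (gram D (supp zstar)))
    (hHerm : (gram D (supp zstar)).IsHermitian)
    (μ : ℝ) (hμpos : 0 < μ)
    (hμle : ∀ i, μ ≤ hHerm.eigenvalues i)
    (hμmem : ∃ i, hHerm.eigenvalues i = μ)
    (zseq : ℕ → Fin n → ℝ)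
    (hconv : Filter.Tendsto zseq Filter.atTop (nhds zstar))
    (N₀ : ℕ) (hsupp : ∀ k, N₀ ≤ k → supp (zseq k) = supp zstar)
    (Jfun : ℕ → Matrix (Fin n) (Fin n) ℝ)
    (hJstep : ∀ k, Jfun (k + 1) = rowMask (supp (zseq (k + 1)))
      (Gmat D L * Jfun k + umat D y l L (zseq k))) :
    Filter.Tendsto Jfun Filter.atTop (nhds (Jstar D y l zstar (supp zstar))) := by
  obtain ⟨i₀, -⟩ := hμmem
  have hLpos := pos_of_isUnit_gram D _ hL hGram i₀
  have hoff : ∀ k, ∀ i ∉ supp zstar, ∀ j, Jfun (k + (N₀ + 1)) i j = 0 := by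
    intro k i hi j
    rw [← add_assoc, hJstep, hsupp _ (by omega)]
    simp [rowMask, hi]
  rw [← Filter.tendsto_add_atTop_iff_nat (N₀ + 1)]
  refine tendsto_pi_nhds.2 fun i => tendsto_pi_nhds.2 fun j => ?_
  by_cases hi : i ∈ supp zstar
  · have hb : Filter.Tendsto (fun k (p : {i // i ∈ supp zstar}) =>
        Nmat D y l (zseq (k + (N₀ + 1))) p j) Filter.atTop
        (nhds fun p => Nmat D y l zstar p j) :=
      tendsto_pi_nhds.2 fun p => ((continuous_Nmat_apply D y l p j).tendsto _).comp
        ((Filter.tendsto_add_atTop_iff_nat (N₀ + 1)).2 hconv)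
    have h := tendsto_perturbed_gradient_descent (colSub D (supp zstar)) hGram hLpos
      (eunorm_colSub_mulVec_sq_le D _ hL)
      (x := fun k p => Jfun (k + (N₀ + 1)) p j) hb (by
        intro k
        ext p
        have hp := jacobian_step_apply D y l L (zseq (k + (N₀ + 1))) _ _ (hoff k) p j
        rw [add_right_comm, hJstep, hsupp _ (by omega)]
        simpa [rowMask, mul_add] using hp)
    have hlim := tendsto_pi_nhds.1 h ⟨i, hi⟩
    have hval : Jstar D y l zstar (supp zstar) i j =
        (-(((colSub D (supp zstar))ᵀ * colSub D (supp zstar))⁻¹ *ᵥ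
          fun p => Nmat D y l zstar p j)) ⟨i, hi⟩ := by
      simp [Jstar, hi, _root_.gram, Matrix.mul_apply, Matrix.mulVec, dotProduct]
    rw [hval]
    exact hlim
  · simp [hoff _ i hi, Jstar, hi]
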